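/- arXiv:2603.17488 — 5 statements merged into one kernel-verified Lean document; each statement's English description precedes it below -/
import Mathlib

section
/- Let c > 0 and k₀ ∈ ℝ² with c|k₀| < 1, set 𝓈 := √(1 − c²|k₀|²)/c, and let A be the associated dispersion matrix. For ε > 0 and k ∈ ℝ² with ε c²|k|² < 1 define 𝓈^ε(k) := √(1 − ε c²|k|²)/c. Then for every compact set K ⊂ ℝ² there exist constants C > 0 and ε₀ > 0 such that for all ε ∈ (0, ε₀] and all q ∈ K one has ε c² |q + k₀/√ε|² < 1 and | (1/ε) 𝓈^ε(q + k₀/√ε) − 𝓈/ε + (k₀·q)/(√ε 𝓈) + (c/2) qᵀ A q | ≤ C √ε. -/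
open Matrix

noncomputable section

/-- Squared Euclidean norm of a vector in `ℝ²`. -/
def nsq (v : Fin 2 → ℝ) : ℝ := v 0 ^ 2 + v 1 ^ 2

/-- The 2×2 dispersion matrix arising in the paraxial expansion of the vertical
wavenumber, for wave speed `c` and lateral slowness vector `(k₁, k₂)`. -/
def dispMat (c k₁ k₂ : ℝ) : Matrix (Fin 2) (Fin 2) ℝ :=
  (1 - c ^ 2 * (k₁ ^ 2 + k₂ ^ 2)) ^ (-(3 : ℝ) / 2) •
    !![1 - c ^ 2 * k₂ ^ 2, c ^ 2 * k₁ * k₂;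
       c ^ 2 * k₁ * k₂, 1 - c ^ 2 * k₁ ^ 2]

/-- The vertical slowness `𝓈^ε(k) = √(1 − ε c²|k|²)/c` of the Helmholtz equation at
scaled lateral wavenumber `k`. -/
def sVert (c ε : ℝ) (k : Fin 2 → ℝ) : ℝ := Real.sqrt (1 - ε * c ^ 2 * nsq k) / c

lemma core_aux (w c t a b u M : ℝ) (hw : 0 < w) (hc : 0 < c) (ht : 0 < t) (ht1 : t ≤ 1)
    (hM : 0 < M) (ha : |a| ≤ M) (hb : |b| ≤ M)
    (h1 : t * (4 * M) ≤ w) (h2 : t * (24 * M ^ 2) ≤ w ^ 2)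
    (hu : u = (w - t * a - t ^ 2 * b) ^ 2 - 2 * t ^ 3 * a * b - t ^ 4 * b ^ 2) :
    0 < u ∧ |(1 / t ^ 2) * (Real.sqrt u / c) - w / c / t ^ 2 + a / (t * c) + b / c|
      ≤ 6 * M ^ 2 / (w * c) * t := by
  have ht2 : t ^ 2 ≤ t := by nlinarith
  have hta : |t * a| ≤ t * M := by
    rw [abs_mul, abs_of_pos ht]; exact mul_le_mul_of_nonneg_left ha ht.le
  have htb : |t ^ 2 * b| ≤ t * M := by
    rw [abs_mul, abs_of_pos (by positivity : 0 < t ^ 2)]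
    exact mul_le_mul ht2 hb (abs_nonneg _) ht.le
  have hP : w / 2 ≤ w - t * a - t ^ 2 * b := by
    have := (abs_le.1 hta).2
    have := (abs_le.1 htb).2
    linarith
  have hE : |2 * t ^ 3 * a * b + t ^ 4 * b ^ 2| ≤ 3 * M ^ 2 * t ^ 3 := by
    have e : 2 * t ^ 3 * a * b + t ^ 4 * b ^ 2 = t ^ 3 * ((2 * a + t * b) * b) := by ring
    rw [e, abs_mul, abs_mul, abs_of_pos (by positivity : 0 < t ^ 3)]
    have h3 : |2 * a + t * b| ≤ 3 * M := by
      refine (abs_add_le _ _).trans ?_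
      rw [abs_mul, abs_mul, abs_of_pos ht, abs_of_pos (by norm_num : (0:ℝ) < 2)]
      have : t * |b| ≤ 1 * M := mul_le_mul ht1 hb (abs_nonneg _) (by norm_num)
      linarith
    have h4 : |2 * a + t * b| * |b| ≤ 3 * M * M :=
      mul_le_mul h3 hb (abs_nonneg _) (by positivity)
    have := mul_le_mul_of_nonneg_left h4 (by positivity : 0 ≤ t ^ 3)
    linarith
  have hE' : 3 * M ^ 2 * t ^ 3 ≤ w ^ 2 / 8 := by
    have : t ^ 3 ≤ t := by nlinarith
    have := mul_le_mul_of_nonneg_left this (by positivity : 0 ≤ 3 * M ^ 2)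
    linarith
  set P := w - t * a - t ^ 2 * b with hPd
  have hu0 : 0 < u := by
    have := (abs_le.1 hE).2
    have : w ^ 2 / 4 ≤ P ^ 2 := by nlinarith
    nlinarith [sq_pos_of_pos hw]
  refine ⟨hu0, ?_⟩
  have hR := Real.sqrt_nonneg u
  have hRs := Real.sq_sqrt hu0.le
  set R := Real.sqrt u
  have key : |R - P| * (w / 2) ≤ 3 * M ^ 2 * t ^ 3 := by
    have e : |R - P| * (R + P) = |2 * t ^ 3 * a * b + t ^ 4 * b ^ 2| := by
      rw [← abs_of_pos (by linarith : 0 < R + P), ← abs_mul, ← abs_neg]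
      congr 1
      linarith
    have := mul_le_mul_of_nonneg_left (by linarith : w / 2 ≤ R + P) (abs_nonneg (R - P))
    linarith
  have e2 : (1 / t ^ 2) * (R / c) - w / c / t ^ 2 + a / (t * c) + b / c
      = (R - P) / (c * t ^ 2) := by
    rw [hPd]; field_simp; ring
  rw [e2, abs_div, abs_of_pos (by positivity : 0 < c * t ^ 2), div_le_iff₀ (by positivity)]
  have e3 : 6 * M ^ 2 / (w * c) * t * (c * t ^ 2) = 3 * M ^ 2 * t ^ 3 / (w / 2) := by
    field_simp; ring
  rw [e3, le_div_iff₀ (by positivity)]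
  exact key

/-- Paraxial expansion of the vertical slowness: uniformly for `q` in a compact set,
`(1/ε) 𝓈^ε(q + k₀/√ε) = 𝓈/ε − (k₀·q)/(√ε 𝓈) − (c/2) qᵀ A q + O(√ε)`. -/
theorem vertical_slowness_expansion (c : ℝ) (hc : 0 < c) (k₀ : Fin 2 → ℝ)
    (hk : c * Real.sqrt (nsq k₀) < 1)
    (K : Set (Fin 2 → ℝ)) (hK : IsCompact K) :
    ∃ C > 0, ∃ ε₀ > 0, ∀ ε : ℝ, 0 < ε → ε ≤ ε₀ → ∀ q ∈ K,
      ε * c ^ 2 * nsq (q + (Real.sqrt ε)⁻¹ • k₀) < 1 ∧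
      |(1 / ε) * sVert c ε (q + (Real.sqrt ε)⁻¹ • k₀)
          - (Real.sqrt (1 - c ^ 2 * nsq k₀) / c) / ε
          + (k₀ ⬝ᵥ q) / (Real.sqrt ε * (Real.sqrt (1 - c ^ 2 * nsq k₀) / c))
          + (c / 2) * (q ⬝ᵥ (dispMat c (k₀ 0) (k₀ 1)).mulVec q)|
        ≤ C * Real.sqrt ε := by
  have hn0 : 0 ≤ nsq k₀ := by unfold nsq; positivity
  have hv : 0 < 1 - c ^ 2 * nsq k₀ := by
    have h1 := Real.sq_sqrt hn0
    have h2 := Real.sqrt_nonneg (nsq k₀)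
    have h3 : 0 ≤ c * Real.sqrt (nsq k₀) := by positivity
    have : c ^ 2 * nsq k₀ = (c * Real.sqrt (nsq k₀)) ^ 2 := by rw [mul_pow, h1]
    rw [this]; nlinarith
  have hw : 0 < Real.sqrt (1 - c ^ 2 * nsq k₀) := Real.sqrt_pos.2 hv
  have hw2 := Real.sq_sqrt hv.le
  have hpow : (1 - c ^ 2 * (k₀ 0 ^ 2 + k₀ 1 ^ 2)) ^ (-(3 : ℝ) / 2)
      = 1 / Real.sqrt (1 - c ^ 2 * nsq k₀) ^ 3 := by
    change (1 - c ^ 2 * nsq k₀) ^ (-(3 : ℝ) / 2) = _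
    generalize 1 - c ^ 2 * nsq k₀ = v at hv
    rw [Real.sqrt_eq_rpow, ← Real.rpow_natCast, ← Real.rpow_mul hv.le, one_div,
      ← Real.rpow_neg hv.le]
    norm_num
  set w := Real.sqrt (1 - c ^ 2 * nsq k₀) with hwd
  let a : (Fin 2 → ℝ) → ℝ := fun q => c ^ 2 * (k₀ 0 * q 0 + k₀ 1 * q 1) / w
  let b : (Fin 2 → ℝ) → ℝ := fun q => c ^ 2 * (q 0 ^ 2 + q 1 ^ 2) / (2 * w)
    + c ^ 4 * (k₀ 0 * q 0 + k₀ 1 * q 1) ^ 2 / (2 * w ^ 3)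
  have hac : Continuous a := by fun_prop
  have hbc : Continuous b := by fun_prop
  obtain ⟨Ma, hMa⟩ := hK.exists_bound_of_continuousOn hac.continuousOn
  obtain ⟨Mb, hMb⟩ := hK.exists_bound_of_continuousOn hbc.continuousOn
  obtain ⟨M, hM, hMa', hMb'⟩ : ∃ M : ℝ, 0 < M ∧ Ma ≤ M ∧ Mb ≤ M :=
    ⟨max 1 (max Ma Mb), by positivity, by simp, by simp⟩
  obtain ⟨δ, hδ, hδ1, hδ2, hδ3⟩ : ∃ δ : ℝ, 0 < δ ∧ δ ≤ 1 ∧ δ ≤ w / (4 * M) ∧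
      δ ≤ w ^ 2 / (24 * M ^ 2) :=
    ⟨min 1 (min (w / (4 * M)) (w ^ 2 / (24 * M ^ 2))), by positivity, by simp, by simp, by simp⟩
  refine ⟨6 * M ^ 2 / (w * c), by positivity, δ ^ 2, by positivity, ?_⟩
  intro ε hε hεδ q hq
  have ht : 0 < Real.sqrt ε := Real.sqrt_pos.2 hε
  have htδ : Real.sqrt ε ≤ δ := Real.sqrt_le_iff.2 ⟨hδ.le, hεδ⟩
  have htε := Real.sq_sqrt hε.le
  set t := Real.sqrt ε with htd
  have hcore := core_aux w c t (a q) (b q) (1 - ε * c ^ 2 * nsq (q + t⁻¹ • k₀)) M hw hc ht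
    (htδ.trans hδ1) hM ((hMa q hq).trans hMa') ((hMb q hq).trans hMb')
    ((le_div_iff₀ (by positivity)).1 (htδ.trans hδ2))
    ((le_div_iff₀ (by positivity)).1 (htδ.trans hδ3)) (by
      have e1 : ε * c ^ 2 * nsq (q + t⁻¹ • k₀)
          = c ^ 2 * ((t * q 0 + k₀ 0) ^ 2 + (t * q 1 + k₀ 1) ^ 2) := by
        rw [← htε]; simp only [nsq, Pi.add_apply, Pi.smul_apply, smul_eq_mul]
        field_simp
      have e2 : (1:ℝ) = w ^ 2 + c ^ 2 * (k₀ 0 ^ 2 + k₀ 1 ^ 2) := by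
        rw [hw2]; simp only [nsq]; ring
      have e3 : 2 * w * b q = c ^ 2 * (q 0 ^ 2 + q 1 ^ 2) + a q ^ 2 := by
        simp only [a, b]; field_simp
      have e4 : w * a q = c ^ 2 * (k₀ 0 * q 0 + k₀ 1 * q 1) := by
        simp only [a]; field_simp
      rw [e1]
      linear_combination e2 + t ^ 2 * e3 + 2 * t * e4)
  refine ⟨by linarith [hcore.1], ?_⟩
  refine le_of_eq_of_le (congrArg abs ?_) hcore.2
  have f1 : (k₀ ⬝ᵥ q) / (t * (w / c)) = a q / (t * c) := by
    simp only [a, dotProduct, Fin.sum_univ_two]; field_simp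
  have f2 : (c / 2) * (q ⬝ᵥ (dispMat c (k₀ 0) (k₀ 1)).mulVec q) = b q / c := by
    have e2 : w ^ 2 = 1 - c ^ 2 * (k₀ 0 ^ 2 + k₀ 1 ^ 2) := hw2
    unfold dispMat
    rw [hpow]
    simp [b, dotProduct, Fin.sum_univ_two, Matrix.mulVec]
    field_simp
    rw [e2]; ring
  rw [f1, f2, htε]
  rfl
end
end

section
/- With the reflection geometry data below, for every ε > 0, γ ∈ (1/2, 1] and p ∈ ℝ² one has |x_int + ε^{1−γ} y_p^ref|² / |x_int|² = (1 + ξ_ε (p·k₀)/cos²(θ_inc))² + ξ_ε² (p·k₀⊥)², where ξ_ε := ε^{1−γ} c₀² / sin²(θ_inc). -/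
open Matrix

noncomputable section

/-- Lateral amplification identity for the reflected speckle: with
`x_int = z_int k₀/𝓈₀`, `y_p = z_int c₀ A₀ p` and `ξ_ε = ε^{1−γ} c₀²/sin²(θ_inc)`,
`|x_int + ε^{1−γ} y_p|²/|x_int|²
  = (1 + ξ_ε (p·k₀)/cos²(θ_inc))² + ξ_ε² (p·k₀⊥)²`. -/
theorem reflected_speckle_amplification
    (c₀ : ℝ) (hc₀ : 0 < c₀) (k₀ : Fin 2 → ℝ)
    (hk₀pos : 0 < Real.sqrt (nsq k₀)) (hk₀lt : Real.sqrt (nsq k₀) < 1 / c₀)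
    (z_int : ℝ) (hz : 0 < z_int)
    (ε γ : ℝ) (hε : 0 < ε) (hγ₁ : 1 / 2 < γ) (hγ₂ : γ ≤ 1)
    (p : Fin 2 → ℝ)
    (s₀ θinc ξ : ℝ) (A₀ : Matrix (Fin 2) (Fin 2) ℝ) (xint yp kperp : Fin 2 → ℝ)
    (hs₀ : s₀ = Real.sqrt (1 - c₀ ^ 2 * nsq k₀) / c₀)
    (hθinc : θinc = Real.arctan (Real.sqrt (nsq k₀) / s₀))
    (hA₀ : A₀ = dispMat c₀ (k₀ 0) (k₀ 1))
    (hxint : xint = (z_int / s₀) • k₀)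
    (hyp : yp = (z_int * c₀) • A₀.mulVec p)
    (hkperp : kperp = ![-(k₀ 1), k₀ 0])
    (hξ : ξ = ε ^ (1 - γ) * c₀ ^ 2 / Real.sin θinc ^ 2) :
    nsq (xint + ε ^ (1 - γ) • yp) / nsq xint =
      (1 + ξ * (p ⬝ᵥ k₀) / Real.cos θinc ^ 2) ^ 2 + ξ ^ 2 * (p ⬝ᵥ kperp) ^ 2 := by
  have hn : 0 < nsq k₀ := Real.sqrt_pos.mp hk₀pos
  have hnk : nsq k₀ = k₀ 0 ^ 2 + k₀ 1 ^ 2 := rfl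
  have hlt : c₀ ^ 2 * nsq k₀ < 1 := by
    have h1 : Real.sqrt (nsq k₀) * c₀ < 1 := (lt_div_iff₀ hc₀).mp hk₀lt
    have h2 : Real.sqrt (nsq k₀) ^ 2 = nsq k₀ := Real.sq_sqrt hn.le
    have h3 : 0 < Real.sqrt (nsq k₀) * c₀ := mul_pos hk₀pos hc₀
    nlinarith
  have hD : 0 < 1 - c₀ ^ 2 * nsq k₀ := by linarith
  obtain ⟨r, hr⟩ : ∃ r, r = Real.sqrt (1 - c₀ ^ 2 * nsq k₀) := ⟨_, rfl⟩
  have hrpos : 0 < r := hr ▸ Real.sqrt_pos.mpr hD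
  have hr2 : r ^ 2 = 1 - c₀ ^ 2 * nsq k₀ := hr ▸ Real.sq_sqrt hD.le
  have hpow : (1 - c₀ ^ 2 * (k₀ 0 ^ 2 + k₀ 1 ^ 2)) ^ (-(3 : ℝ) / 2) = (r ^ 3)⁻¹ := by
    rw [← hnk, ← hr2, ← Real.rpow_natCast r 2, ← Real.rpow_mul hrpos.le,
      ← Real.rpow_natCast r 3, ← Real.rpow_neg hrpos.le]
    norm_num
  rw [← hr] at hs₀
  have hs : 0 < s₀ := hs₀ ▸ div_pos hrpos hc₀
  have hcos : Real.cos θinc ^ 2 = r ^ 2 := by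
    rw [hθinc, Real.cos_sq_arctan, div_pow, Real.sq_sqrt hn.le, hs₀]
    have : 1 + nsq k₀ / (r / c₀) ^ 2 = 1 / r ^ 2 := by
      field_simp
      linarith
    rw [this]; simp
  have hsin : Real.sin θinc ^ 2 = c₀ ^ 2 * nsq k₀ := by
    rw [Real.sin_sq, hcos, hr2]; ring
  generalize ε ^ (1 - γ) = e at *
  have hξ' : ξ = e / nsq k₀ := by
    rw [hξ, hsin]; field_simp
  rw [hcos, hξ', hxint, hyp, hkperp, hA₀, hs₀, dispMat, hpow]
  obtain ⟨a, ha⟩ : ∃ a, a = k₀ 0 := ⟨_, rfl⟩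
  obtain ⟨b, hb⟩ : ∃ b, b = k₀ 1 := ⟨_, rfl⟩
  obtain ⟨n, hn'⟩ : ∃ n, n = nsq k₀ := ⟨_, rfl⟩
  rw [← hn'] at hn hr2 hnk ⊢
  rw [← ha, ← hb] at hnk ⊢
  have e1 : 1 - c₀ ^ 2 * b ^ 2 = r ^ 2 + c₀ ^ 2 * a ^ 2 := by rw [hr2, hnk]; ring
  have e2 : 1 - c₀ ^ 2 * a ^ 2 = r ^ 2 + c₀ ^ 2 * b ^ 2 := by rw [hr2, hnk]; ring
  have hx : nsq ((z_int / (r / c₀)) • k₀) = (z_int * c₀ / r) ^ 2 * n := by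
    simp only [nsq, Pi.smul_apply, smul_eq_mul, ← ha, ← hb, hnk]
    field_simp
  rw [hx, e1, e2]
  have hy : nsq ((z_int / (r / c₀)) • k₀ + e • (z_int * c₀) •
      (((r ^ 3)⁻¹ • !![r ^ 2 + c₀ ^ 2 * a ^ 2, c₀ ^ 2 * a * b;
        c₀ ^ 2 * a * b, r ^ 2 + c₀ ^ 2 * b ^ 2]) *ᵥ p)) =
      (z_int * c₀ / r) ^ 2 *
       ((a + e * (r ^ 2 * p 0 + c₀ ^ 2 * a * (a * p 0 + b * p 1)) / r ^ 2) ^ 2 +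
        (b + e * (r ^ 2 * p 1 + c₀ ^ 2 * b * (a * p 0 + b * p 1)) / r ^ 2) ^ 2) := by
    simp [nsq, Matrix.mulVec, dotProduct, Fin.sum_univ_two, ← ha, ← hb]
    field_simp
    ring
  rw [hy]
  simp only [dotProduct, Fin.sum_univ_two, ← ha, ← hb, Matrix.cons_val_zero, Matrix.cons_val_one]
  rw [mul_div_mul_left _ _ (by positivity)]
  have hc2 : c₀ ^ 2 = (1 - r ^ 2) / n := by rw [hr2]; field_simp; ring
  rw [hc2]
  have hab : a ^ 2 = n - b ^ 2 := by rw [hnk]; ring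
  have hne := hn.ne'
  clear hr2 e1 e2 hy hx hc2
  subst hnk
  field_simp
  ring
end
end

section
/- With the transmission geometry data below, for every ε > 0, γ ∈ (1/2, 1] and p ∈ ℝ² one has |x_tr + ε^{1−γ} y_p^tr|² / |x_tr|² = (1 + ξ_ε (p·k₀)/cos²(θ_tr⁰))² + ξ_ε² (p·k₀⊥)², where ξ_ε := ε^{1−γ} c₀² / sin²(θ_inc). -/
open Matrix

noncomputable section

/-- Lateral amplification identity for the transmitted speckle: with
`x_tr = (z_tr − z_int) k₀/𝓈₁`, `y_p = (z_tr − z_int) c₁ A₁ p` and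
`ξ_ε = ε^{1−γ} c₀²/sin²(θ_inc)`,
`|x_tr + ε^{1−γ} y_p|²/|x_tr|²
  = (1 + ξ_ε (p·k₀)/cos²(θ_tr⁰))² + ξ_ε² (p·k₀⊥)²`. -/
theorem transmitted_speckle_amplification
    (c₀ c₁ : ℝ) (hc₀ : 0 < c₀) (hc₁ : 0 < c₁) (k₀ : Fin 2 → ℝ)
    (hk₀pos : 0 < Real.sqrt (nsq k₀)) (hk₀lt₀ : Real.sqrt (nsq k₀) < 1 / c₀)
    (hk₀lt₁ : Real.sqrt (nsq k₀) < 1 / c₁)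
    (z_int z_tr : ℝ) (hz : 0 < z_int) (hz' : z_int < z_tr)
    (ε γ : ℝ) (hε : 0 < ε) (hγ₁ : 1 / 2 < γ) (hγ₂ : γ ≤ 1)
    (p : Fin 2 → ℝ)
    (s₀ s₁ θinc θtr ξ : ℝ) (A₁ : Matrix (Fin 2) (Fin 2) ℝ) (xtr yp kperp : Fin 2 → ℝ)
    (hs₀ : s₀ = Real.sqrt (1 - c₀ ^ 2 * nsq k₀) / c₀)
    (hs₁ : s₁ = Real.sqrt (1 - c₁ ^ 2 * nsq k₀) / c₁)
    (hθinc : θinc = Real.arctan (Real.sqrt (nsq k₀) / s₀))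
    (hθtr : θtr = Real.arctan (Real.sqrt (nsq k₀) / s₁))
    (hA₁ : A₁ = dispMat c₁ (k₀ 0) (k₀ 1))
    (hxtr : xtr = ((z_tr - z_int) / s₁) • k₀)
    (hyp : yp = ((z_tr - z_int) * c₁) • A₁.mulVec p)
    (hkperp : kperp = ![-(k₀ 1), k₀ 0])
    (hξ : ξ = ε ^ (1 - γ) * c₀ ^ 2 / Real.sin θinc ^ 2) :
    nsq (xtr + ε ^ (1 - γ) • yp) / nsq xtr =
      (1 + ξ * (p ⬝ᵥ k₀) / Real.cos θtr ^ 2) ^ 2 + ξ ^ 2 * (p ⬝ᵥ kperp) ^ 2 := by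
  have hN : 0 < nsq k₀ := Real.sqrt_pos.mp hk₀pos
  set r := Real.sqrt (nsq k₀) with hr
  have hr2 : r ^ 2 = nsq k₀ := Real.sq_sqrt hN.le
  have key : ∀ c : ℝ, 0 < c → r < 1 / c → 0 < 1 - c ^ 2 * nsq k₀ := by
    intro c hc h
    rw [lt_div_iff₀ hc] at h
    have h0 : 0 < r * c := mul_pos hk₀pos hc
    rw [← hr2]
    nlinarith
  have hw₀ := key c₀ hc₀ hk₀lt₀
  have hw₁ := key c₁ hc₁ hk₀lt₁
  have hcos : ∀ c : ℝ, 0 < c → 0 < 1 - c ^ 2 * nsq k₀ →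
      Real.cos (Real.arctan (r / (Real.sqrt (1 - c ^ 2 * nsq k₀) / c))) ^ 2
        = 1 - c ^ 2 * nsq k₀ := by
    intro c hc hw
    rw [Real.cos_sq_arctan, div_pow, div_pow, Real.sq_sqrt hw.le, hr2]
    have h1 : 1 + nsq k₀ / ((1 - c ^ 2 * nsq k₀) / c ^ 2) = 1 / (1 - c ^ 2 * nsq k₀) := by
      have := hw.ne'
      rw [eq_div_iff this, div_div_eq_mul_div, add_mul, div_mul_cancel₀ _ this]
      ring
    rw [h1, one_div_one_div]
  have hsin : Real.sin θinc ^ 2 = c₀ ^ 2 * nsq k₀ := by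
    rw [Real.sin_sq, hθinc, hs₀, hcos c₀ hc₀ hw₀]; ring
  have hct : Real.cos θtr ^ 2 = 1 - c₁ ^ 2 * nsq k₀ := by
    rw [hθtr, hs₁, hcos c₁ hc₁ hw₁]
  have hξ' : ξ = ε ^ (1 - γ) / nsq k₀ := by
    rw [hξ, hsin]; field_simp
  generalize ε ^ (1 - γ) = e at *
  have hd : 0 < z_tr - z_int := sub_pos.mpr hz'
  generalize z_tr - z_int = d at *
  have hNe : nsq k₀ = k₀ 0 ^ 2 + k₀ 1 ^ 2 := rfl
  have hpow : (1 - c₁ ^ 2 * (k₀ 0 ^ 2 + k₀ 1 ^ 2)) ^ (-(3 : ℝ) / 2)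
      = 1 / ((1 - c₁ ^ 2 * nsq k₀) * Real.sqrt (1 - c₁ ^ 2 * nsq k₀)) := by
    rw [← hNe, show (-(3 : ℝ) / 2) = -(1 + 1 / 2) by norm_num, Real.rpow_neg hw₁.le,
      Real.rpow_add hw₁, Real.rpow_one, ← Real.sqrt_eq_rpow, one_div]
  have hsq := Real.sq_sqrt hw₁.le
  have hsp := Real.sqrt_pos.mpr hw₁
  rw [hs₁] at hxtr
  generalize Real.sqrt (1 - c₁ ^ 2 * nsq k₀) = q at *
  have hq := hsp.ne'
  have hx0 : ∀ i, xtr i = d * c₁ / q * k₀ i := by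
    intro i
    rw [hxtr, Pi.smul_apply, smul_eq_mul]
    field_simp
  have hy0 : yp 0 = d * c₁ / q ^ 3 * ((1 - c₁ ^ 2 * k₀ 1 ^ 2) * p 0 + c₁ ^ 2 * k₀ 0 * k₀ 1 * p 1) := by
    rw [hyp, hA₁, dispMat, hpow, ← hsq]
    simp [Matrix.mulVec, dotProduct, Fin.sum_univ_two]
    field_simp
  have hy1 : yp 1 = d * c₁ / q ^ 3 * (c₁ ^ 2 * k₀ 0 * k₀ 1 * p 0 + (1 - c₁ ^ 2 * k₀ 0 ^ 2) * p 1) := by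
    rw [hyp, hA₁, dispMat, hpow, ← hsq]
    simp [Matrix.mulVec, dotProduct, Fin.sum_univ_two]
    field_simp
  have hpk : p ⬝ᵥ k₀ = p 0 * k₀ 0 + p 1 * k₀ 1 := by
    simp [dotProduct, Fin.sum_univ_two]
  have hpp : p ⬝ᵥ kperp = p 1 * k₀ 0 - p 0 * k₀ 1 := by
    simp [hkperp, dotProduct, Fin.sum_univ_two]; ring
  rw [hpk, hpp, hct, ← hsq, hξ']
  have hz0 : (xtr + e • yp) 0 = d * c₁ / q * ((1 + e / nsq k₀ * (p 0 * k₀ 0 + p 1 * k₀ 1) / q ^ 2) * k₀ 0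
      - e / nsq k₀ * (p 1 * k₀ 0 - p 0 * k₀ 1) * k₀ 1) := by
    rw [Pi.add_apply, Pi.smul_apply, smul_eq_mul, hx0, hy0]
    have := hN.ne'
    field_simp
    rw [hsq, hNe]
    ring
  have hz1 : (xtr + e • yp) 1 = d * c₁ / q * ((1 + e / nsq k₀ * (p 0 * k₀ 0 + p 1 * k₀ 1) / q ^ 2) * k₀ 1
      + e / nsq k₀ * (p 1 * k₀ 0 - p 0 * k₀ 1) * k₀ 0) := by
    rw [Pi.add_apply, Pi.smul_apply, smul_eq_mul, hx0, hy1]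
    have := hN.ne'
    field_simp
    rw [hsq, hNe]
    ring
  generalize 1 + e / nsq k₀ * (p 0 * k₀ 0 + p 1 * k₀ 1) / q ^ 2 = a at *
  rw [← mul_pow]
  generalize e / nsq k₀ * (p 1 * k₀ 0 - p 0 * k₀ 1) = b at *
  have hxx : nsq xtr = (d * c₁ / q) ^ 2 * nsq k₀ := by
    simp only [nsq, hx0]; ring
  have hpos : 0 < nsq xtr := by rw [hxx]; positivity
  rw [div_eq_iff hpos.ne', hxx, hNe, nsq, hz0, hz1]
  ring
end
end

section
/- Generalized Snell's law of reflection: with the reflection geometry data below, for every ε > 0, γ ∈ (1/2, 1] and p ∈ ℝ², define the speckle reflection angle θ_ref^ε(p) := arctan(|x_int + ε^{1−γ} y_p^ref| / z_int) and Ξ := (1 + ξ_ε (p·k₀)/cos²(θ_inc))² + ξ_ε² (p·k₀⊥)² with ξ_ε := ε^{1−γ} c₀²/sin²(θ_inc). Then sin(θ_ref^ε(p))/c₀ = sin(θ_inc)/c₀ + |k₀| · ( √( Ξ / (1 + sin²(θ_inc)(Ξ − 1)) ) − 1 ). -/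
open Matrix

noncomputable section

/-- Generalized Snell's law of reflection: with speckle reflection angle
`θ_ref^ε(p) = arctan(|x_int + ε^{1−γ} y_p^ref|/z_int)` and
`Ξ = (1 + ξ_ε (p·k₀)/cos²(θ_inc))² + ξ_ε² (p·k₀⊥)²`, one has
`sin(θ_ref^ε(p))/c₀ = sin(θ_inc)/c₀ + |k₀| (√(Ξ/(1 + sin²(θ_inc)(Ξ − 1))) − 1)`. -/
theorem generalized_snell_reflection
    (c₀ : ℝ) (hc₀ : 0 < c₀) (k₀ : Fin 2 → ℝ)
    (hk₀pos : 0 < Real.sqrt (nsq k₀)) (hk₀lt : Real.sqrt (nsq k₀) < 1 / c₀)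
    (z_int : ℝ) (hz : 0 < z_int)
    (ε γ : ℝ) (hε : 0 < ε) (hγ₁ : 1 / 2 < γ) (hγ₂ : γ ≤ 1)
    (p : Fin 2 → ℝ)
    (s₀ θinc ξ θref Ξ : ℝ) (A₀ : Matrix (Fin 2) (Fin 2) ℝ) (xint yp kperp : Fin 2 → ℝ)
    (hs₀ : s₀ = Real.sqrt (1 - c₀ ^ 2 * nsq k₀) / c₀)
    (hθinc : θinc = Real.arctan (Real.sqrt (nsq k₀) / s₀))
    (hA₀ : A₀ = dispMat c₀ (k₀ 0) (k₀ 1))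
    (hxint : xint = (z_int / s₀) • k₀)
    (hyp : yp = (z_int * c₀) • A₀.mulVec p)
    (hkperp : kperp = ![-(k₀ 1), k₀ 0])
    (hξ : ξ = ε ^ (1 - γ) * c₀ ^ 2 / Real.sin θinc ^ 2)
    (hθref : θref = Real.arctan (Real.sqrt (nsq (xint + ε ^ (1 - γ) • yp)) / z_int))
    (hΞ : Ξ = (1 + ξ * (p ⬝ᵥ k₀) / Real.cos θinc ^ 2) ^ 2 + ξ ^ 2 * (p ⬝ᵥ kperp) ^ 2) :
    Real.sin θref / c₀ =
      Real.sin θinc / c₀ +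
        Real.sqrt (nsq k₀) *
          (Real.sqrt (Ξ / (1 + Real.sin θinc ^ 2 * (Ξ - 1))) - 1) := by
  obtain ⟨n, hn⟩ : ∃ n, n = Real.sqrt (nsq k₀) := ⟨_, rfl⟩
  have hnn : 0 ≤ nsq k₀ := by unfold nsq; positivity
  have hn2 : nsq k₀ = n ^ 2 := by rw [hn, Real.sq_sqrt hnn]
  rw [← hn] at hk₀pos hk₀lt hθinc ⊢
  have hcn : c₀ * n < 1 := by
    rw [lt_div_iff₀ hc₀] at hk₀lt
    linarith
  have hcn0 : 0 < c₀ * n := by positivity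
  have hQ : 0 < 1 - c₀ ^ 2 * n ^ 2 := by nlinarith
  obtain ⟨q, hq⟩ : ∃ q, q = Real.sqrt (1 - c₀ ^ 2 * n ^ 2) := ⟨_, rfl⟩
  have hq0 : 0 < q := hq ▸ Real.sqrt_pos.mpr hQ
  have hq2 : q ^ 2 = 1 - c₀ ^ 2 * n ^ 2 := by rw [hq, Real.sq_sqrt hQ.le]
  rw [hn2, ← hq] at hs₀
  have harg : n / s₀ = c₀ * n / q := by
    rw [hs₀]; field_simp
  have hroot : Real.sqrt (1 + (c₀ * n / q) ^ 2) = 1 / q := by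
    rw [Real.sqrt_eq_iff_mul_self_eq (by positivity) (by positivity)]
    field_simp
    nlinarith
  have hsin : Real.sin θinc = c₀ * n := by
    rw [hθinc, harg, Real.sin_arctan, hroot]; field_simp
  have hcos : Real.cos θinc = q := by
    rw [hθinc, harg, Real.cos_arctan, hroot]; field_simp
  have hpow : (1 - c₀ ^ 2 * (k₀ 0 ^ 2 + k₀ 1 ^ 2)) ^ (-(3 : ℝ) / 2) = 1 / q ^ 3 := by
    have h1 : (1 - c₀ ^ 2 * (k₀ 0 ^ 2 + k₀ 1 ^ 2)) = q ^ (2 : ℝ) := by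
      rw [Real.rpow_two, hq2, ← hn2, nsq]
    rw [h1, ← Real.rpow_mul hq0.le]
    norm_num
  obtain ⟨e, he⟩ : ∃ e, e = ε ^ (1 - γ) := ⟨_, rfl⟩
  rw [← he] at hξ hθref
  have hξ' : ξ = e / n ^ 2 := by
    rw [hξ, hsin]; field_simp
  have hkk : k₀ 0 ^ 2 + k₀ 1 ^ 2 = n ^ 2 := by rw [← hn2, nsq]
  have hΞ0 : 0 ≤ Ξ := by rw [hΞ]; positivity
  have hpk : p ⬝ᵥ k₀ = p 0 * k₀ 0 + p 1 * k₀ 1 := by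
    simp [dotProduct, Fin.sum_univ_two]
  have hpp : p ⬝ᵥ kperp = p 1 * k₀ 0 - p 0 * k₀ 1 := by
    simp [hkperp, dotProduct, Fin.sum_univ_two]; ring
  rw [hcos, hpk, hpp, hξ'] at hΞ
  have h0 : (xint + e • yp) 0 = z_int * c₀ / q * (k₀ 0 * (1 + e / n ^ 2 * (p 0 * k₀ 0 + p 1 * k₀ 1) / q ^ 2)
      - k₀ 1 * (e / n ^ 2 * (p 1 * k₀ 0 - p 0 * k₀ 1))) := by
    simp only [hxint, hyp, hA₀, dispMat, hpow, hs₀, Pi.add_apply, Pi.smul_apply, smul_eq_mul,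
      Matrix.smul_mulVec, Matrix.mulVec, dotProduct, Fin.sum_univ_two, Matrix.of_apply,
      Matrix.cons_val_zero, Matrix.cons_val_one]
    field_simp
    rw [hq2, ← hkk]
    ring
  have h1 : (xint + e • yp) 1 = z_int * c₀ / q * (k₀ 1 * (1 + e / n ^ 2 * (p 0 * k₀ 0 + p 1 * k₀ 1) / q ^ 2)
      + k₀ 0 * (e / n ^ 2 * (p 1 * k₀ 0 - p 0 * k₀ 1))) := by
    simp only [hxint, hyp, hA₀, dispMat, hpow, hs₀, Pi.add_apply, Pi.smul_apply, smul_eq_mul,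
      Matrix.smul_mulVec, Matrix.mulVec, dotProduct, Fin.sum_univ_two, Matrix.of_apply,
      Matrix.cons_val_zero, Matrix.cons_val_one]
    field_simp
    rw [hq2, ← hkk]
    ring
  have hN : nsq (xint + e • yp) = (z_int * (c₀ * n / q)) ^ 2 * Ξ := by
    have : (z_int * (c₀ * n / q)) ^ 2 = (z_int * c₀ / q) ^ 2 * (k₀ 0 ^ 2 + k₀ 1 ^ 2) := by
      rw [hkk]; ring
    rw [this, nsq, h0, h1, hΞ]
    ring
  have hR : Real.sqrt (nsq (xint + e • yp)) / z_int = c₀ * n / q * Real.sqrt Ξ := by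
    rw [hN, Real.sqrt_mul (by positivity), Real.sqrt_sq (by positivity)]
    field_simp
  have hD : 0 < 1 + (c₀ * n) ^ 2 * (Ξ - 1) := by
    have : 0 ≤ (c₀ * n) ^ 2 * Ξ := by positivity
    have h2 : 1 + (c₀ * n) ^ 2 * (Ξ - 1) = q ^ 2 + (c₀ * n) ^ 2 * Ξ := by rw [hq2]; ring
    rw [h2]; positivity
  have hS : Real.sqrt (1 + (c₀ * n / q * Real.sqrt Ξ) ^ 2)
      = Real.sqrt (1 + (c₀ * n) ^ 2 * (Ξ - 1)) / q := by
    have : 1 + (c₀ * n / q * Real.sqrt Ξ) ^ 2 = (1 + (c₀ * n) ^ 2 * (Ξ - 1)) / q ^ 2 := by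
      rw [mul_pow, Real.sq_sqrt hΞ0]
      field_simp
      rw [hq2]; ring
    rw [this, Real.sqrt_div hD.le, Real.sqrt_sq hq0.le]
  have hD' := Real.sqrt_pos.mpr hD
  rw [hθref, hR, Real.sin_arctan, hS, hsin, Real.sqrt_div hΞ0]
  field_simp
  ring
end
end

section
/- Generalized Snell's law of transmission: with the transmission geometry data below, for every ε > 0, γ ∈ (1/2, 1] and p ∈ ℝ², define the speckle transmission angle θ_tr^ε(p) := arctan(|x_tr + ε^{1−γ} y_p^tr| / (z_tr − z_int)) and Ξ := (1 + ξ_ε (p·k₀)/cos²(θ_tr⁰))² + ξ_ε² (p·k₀⊥)² with ξ_ε := ε^{1−γ} c₀²/sin²(θ_inc). Then sin(θ_tr^ε(p))/c₁ = sin(θ_inc)/c₀ + |k₀| · ( √( Ξ / (1 + sin²(θ_tr⁰)(Ξ − 1)) ) − 1 ). -/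
open Matrix

noncomputable section

theorem sin_arctan_sq_aux (x : ℝ) : Real.sin (Real.arctan x) ^ 2 = x ^ 2 / (1 + x ^ 2) := by
  have h : (0:ℝ) < 1 + x ^ 2 := by positivity
  rw [Real.sin_arctan, div_pow, Real.sq_sqrt h.le]

theorem sin_arctan_nonneg_aux (x : ℝ) (hx : 0 ≤ x) : 0 ≤ Real.sin (Real.arctan x) := by
  rw [Real.sin_arctan]; positivity

theorem lt_aux (c K : ℝ) (hc : 0 < c) (hK : 0 ≤ K) (h : Real.sqrt K < 1 / c) :
    0 < 1 - c ^ 2 * K := by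
  rw [lt_div_iff₀ hc] at h
  have h2 := Real.sq_sqrt hK
  have h3 := Real.sqrt_nonneg K
  have h4 : 0 ≤ Real.sqrt K * c := by positivity
  have : c ^ 2 * K = (Real.sqrt K * c) ^ 2 := by rw [mul_pow, h2]; ring
  rw [this]; nlinarith

theorem sin_sq_aux (c K : ℝ) (hc : 0 < c) (hK : 0 ≤ K) (h : 0 < 1 - c ^ 2 * K) :
    Real.sin (Real.arctan (Real.sqrt K / (Real.sqrt (1 - c ^ 2 * K) / c))) ^ 2 = c ^ 2 * K := by
  rw [sin_arctan_sq_aux, div_pow, div_pow, Real.sq_sqrt hK, Real.sq_sqrt h.le]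
  have h1 : K / ((1 - c ^ 2 * K) / c ^ 2) = c ^ 2 * K / (1 - c ^ 2 * K) := by
    field_simp
  have h2 : 1 + c ^ 2 * K / (1 - c ^ 2 * K) = 1 / (1 - c ^ 2 * K) := by
    field_simp; ring
  rw [h1, h2]
  field_simp

theorem rpow_aux (t : ℝ) (ht : 0 < t) : (t ^ 2) ^ (-(3 : ℝ) / 2) = (t ^ 3)⁻¹ := by
  rw [← Real.rpow_natCast t 2, ← Real.rpow_mul ht.le, ← Real.rpow_natCast t 3,
    ← Real.rpow_neg ht.le]
  norm_num

/-- Generalized Snell's law of transmission: with speckle transmission angle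
`θ_tr^ε(p) = arctan(|x_tr + ε^{1−γ} y_p^tr|/(z_tr − z_int))` and
`Ξ = (1 + ξ_ε (p·k₀)/cos²(θ_tr⁰))² + ξ_ε² (p·k₀⊥)²`, one has
`sin(θ_tr^ε(p))/c₁ = sin(θ_inc)/c₀ + |k₀| (√(Ξ/(1 + sin²(θ_tr⁰)(Ξ − 1))) − 1)`. -/
theorem generalized_snell_transmission
    (c₀ c₁ : ℝ) (hc₀ : 0 < c₀) (hc₁ : 0 < c₁) (k₀ : Fin 2 → ℝ)
    (hk₀pos : 0 < Real.sqrt (nsq k₀)) (hk₀lt₀ : Real.sqrt (nsq k₀) < 1 / c₀)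
    (hk₀lt₁ : Real.sqrt (nsq k₀) < 1 / c₁)
    (z_int z_tr : ℝ) (hz : 0 < z_int) (hz' : z_int < z_tr)
    (ε γ : ℝ) (hε : 0 < ε) (hγ₁ : 1 / 2 < γ) (hγ₂ : γ ≤ 1)
    (p : Fin 2 → ℝ)
    (s₀ s₁ θinc θtr ξ θtrε Ξ : ℝ) (A₁ : Matrix (Fin 2) (Fin 2) ℝ)
    (xtr yp kperp : Fin 2 → ℝ)
    (hs₀ : s₀ = Real.sqrt (1 - c₀ ^ 2 * nsq k₀) / c₀)
    (hs₁ : s₁ = Real.sqrt (1 - c₁ ^ 2 * nsq k₀) / c₁)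
    (hθinc : θinc = Real.arctan (Real.sqrt (nsq k₀) / s₀))
    (hθtr : θtr = Real.arctan (Real.sqrt (nsq k₀) / s₁))
    (hA₁ : A₁ = dispMat c₁ (k₀ 0) (k₀ 1))
    (hxtr : xtr = ((z_tr - z_int) / s₁) • k₀)
    (hyp : yp = ((z_tr - z_int) * c₁) • A₁.mulVec p)
    (hkperp : kperp = ![-(k₀ 1), k₀ 0])
    (hξ : ξ = ε ^ (1 - γ) * c₀ ^ 2 / Real.sin θinc ^ 2)
    (hθtrε : θtrε =
      Real.arctan (Real.sqrt (nsq (xtr + ε ^ (1 - γ) • yp)) / (z_tr - z_int)))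
    (hΞ : Ξ = (1 + ξ * (p ⬝ᵥ k₀) / Real.cos θtr ^ 2) ^ 2 + ξ ^ 2 * (p ⬝ᵥ kperp) ^ 2) :
    Real.sin θtrε / c₁ =
      Real.sin θinc / c₀ +
        Real.sqrt (nsq k₀) *
          (Real.sqrt (Ξ / (1 + Real.sin θtr ^ 2 * (Ξ - 1))) - 1) := by
  have hK : 0 < nsq k₀ := Real.sqrt_pos.mp hk₀pos
  have h0 := lt_aux c₀ _ hc₀ hK.le hk₀lt₀
  have h1 := lt_aux c₁ _ hc₁ hK.le hk₀lt₁
  have hsi : Real.sin θinc ^ 2 = c₀ ^ 2 * nsq k₀ := by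
    rw [hθinc, hs₀]; exact sin_sq_aux _ _ hc₀ hK.le h0
  have hst : Real.sin θtr ^ 2 = c₁ ^ 2 * nsq k₀ := by
    rw [hθtr, hs₁]; exact sin_sq_aux _ _ hc₁ hK.le h1
  have hsi' : Real.sin θinc / c₀ = Real.sqrt (nsq k₀) := by
    have hn : 0 ≤ Real.sin θinc := by
      rw [hθinc, hs₀]; exact sin_arctan_nonneg_aux _ (by positivity)
    have : Real.sin θinc = c₀ * Real.sqrt (nsq k₀) := by
      rw [← sq_eq_sq₀ hn (by positivity), hsi, mul_pow, Real.sq_sqrt hK.le]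
    rw [this]; field_simp
  obtain ⟨t, ht, htt⟩ : ∃ t : ℝ, 0 < t ∧ Real.sqrt (1 - c₁ ^ 2 * nsq k₀) = t :=
    ⟨_, Real.sqrt_pos.mpr h1, rfl⟩
  have ht2 : 1 - c₁ ^ 2 * nsq k₀ = t ^ 2 := by rw [← htt, Real.sq_sqrt h1.le]
  have hct : Real.cos θtr ^ 2 = t ^ 2 := by
    rw [Real.cos_sq', hst, ht2]
  have hξ' : ξ = ε ^ (1 - γ) / nsq k₀ := by
    rw [hξ, hsi]; field_simp
  have hd : 0 < z_tr - z_int := sub_pos.mpr hz'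
  have hΞ0 : 0 ≤ Ξ := by rw [hΞ]; positivity
  generalize ε ^ (1 - γ) = e at *
  have hD : 1 + Real.sin θtr ^ 2 * (Ξ - 1) = t ^ 2 + c₁ ^ 2 * nsq k₀ * Ξ := by
    rw [hst, ← ht2]; ring
  have key : nsq (xtr + e • yp) / (z_tr - z_int) ^ 2 = c₁ ^ 2 * nsq k₀ * Ξ / t ^ 2 := by
    have hw : (1 - c₁ ^ 2 * (k₀ 0 ^ 2 + k₀ 1 ^ 2)) ^ (-(3 : ℝ) / 2) = (t ^ 3)⁻¹ := by
      rw [← rpow_aux t ht, ← ht2]; rfl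
    have e0 : (xtr + e • yp) 0 = (z_tr - z_int) * c₁ / t *
        ((1 + ξ * (p ⬝ᵥ k₀) / t ^ 2) * k₀ 0 + ξ * (p ⬝ᵥ kperp) * (-(k₀ 1))) := by
      rw [hxtr, hyp, hA₁, hs₁, htt, dispMat, hw, hξ', hkperp]
      simp [Matrix.mulVec, dotProduct, Fin.sum_univ_two]
      unfold nsq at *
      field_simp
      rw [← ht2]
      ring
    have e1 : (xtr + e • yp) 1 = (z_tr - z_int) * c₁ / t *
        ((1 + ξ * (p ⬝ᵥ k₀) / t ^ 2) * k₀ 1 + ξ * (p ⬝ᵥ kperp) * k₀ 0) := by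
      rw [hxtr, hyp, hA₁, hs₁, htt, dispMat, hw, hξ', hkperp]
      simp [Matrix.mulVec, dotProduct, Fin.sum_univ_two]
      unfold nsq at *
      field_simp
      rw [← ht2]
      ring
    rw [hΞ, hct, nsq, e0, e1, nsq]
    field_simp
    ring
  have hN : 0 ≤ nsq (xtr + e • yp) := by unfold nsq; positivity
  have hsε : Real.sin θtrε ^ 2 = c₁ ^ 2 * nsq k₀ * Ξ / (t ^ 2 + c₁ ^ 2 * nsq k₀ * Ξ) := by
    rw [hθtrε, sin_arctan_sq_aux, div_pow, Real.sq_sqrt hN, key]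
    have : 0 < t ^ 2 + c₁ ^ 2 * nsq k₀ * Ξ := by positivity
    have h2 : 1 + c₁ ^ 2 * nsq k₀ * Ξ / t ^ 2 = (t ^ 2 + c₁ ^ 2 * nsq k₀ * Ξ) / t ^ 2 := by
      field_simp
    rw [h2]
    field_simp
  have hn : 0 ≤ Real.sin θtrε := by
    rw [hθtrε]; exact sin_arctan_nonneg_aux _ (by positivity)
  have hfin : Real.sin θtrε / c₁ =
      Real.sqrt (nsq k₀) * Real.sqrt (Ξ / (t ^ 2 + c₁ ^ 2 * nsq k₀ * Ξ)) := by
    rw [← sq_eq_sq₀ (by positivity) (by positivity), div_pow, hsε, mul_pow,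
      Real.sq_sqrt hK.le, Real.sq_sqrt (by positivity)]
    field_simp
  rw [hD, hsi', hfin]
  ring
end
end
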